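/- The mini-batch max-sliced Wasserstein loss vanishes on the diagonal only in a weak sense failing identity: for d ≥ 1 and m ≥ 2, there exists a probability measure μ on ℝ^d such that m-Max-SW(μ,μ) > 0. -/

import Mathlib

open MeasureTheory ENNReal

noncomputable section

abbrev Rd (d : ℕ) := EuclideanSpace ℝ (Fin d)

/-- Wasserstein-p distance defined via infimum over couplings. -/
def Wp {E : Type*} [MeasurableSpace E] [EDist E] (p : ℝ) (μ ν : Measure E) : ℝ≥0∞ :=
  ⨅ (π : Measure (E × E)) (_ : π.map Prod.fst = μ ∧ π.map Prod.snd = ν),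
    (∫⁻ q, edist q.1 q.2 ^ p ∂π) ^ (1 / p)

/-- Empirical measure of an `m`-sample in `ℝ^d`. -/
def emp {d m : ℕ} (X : Fin m → Rd d) : Measure (Rd d) :=
  (m : ℝ≥0∞)⁻¹ • ∑ i, Measure.dirac (X i)

/-- Pushforward of a measure on `ℝ^d` by the projection `x ↦ ⟨θ, x⟩`. -/
def proj {d : ℕ} (θ : Rd d) (μ : Measure (Rd d)) : Measure ℝ :=
  μ.map (fun x => inner (𝕜 := ℝ) θ x)

/-- The mini-batch measure `μ^{⊗m} ⊗ ν^{⊗m}`. -/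
def mb {d : ℕ} (m : ℕ) (μ ν : Measure (Rd d)) :
    Measure ((Fin m → Rd d) × (Fin m → Rd d)) :=
  (Measure.pi fun _ => μ).prod (Measure.pi fun _ => ν)

/-- Amortized sliced Wasserstein loss for a family of amortized models indexed by `Ψ`. -/
def ASW {d : ℕ} (p : ℝ) (m : ℕ) {Ψ : Type*}
    (f : Ψ → (Fin m → Rd d) → (Fin m → Rd d) → Rd d)
    (μ ν : Measure (Rd d)) : ℝ≥0∞ :=
  ⨆ ψ, ∫⁻ XY, Wp p (proj (f ψ XY.1 XY.2) (emp XY.1)) (proj (f ψ XY.1 XY.2) (emp XY.2))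
    ∂(mb m μ ν)

/-- Mini-batch max-sliced Wasserstein loss. -/
def mMaxSW {d : ℕ} (p : ℝ) (m : ℕ) (μ ν : Measure (Rd d)) : ℝ≥0∞ :=
  ∫⁻ XY, ⨆ θ : Metric.sphere (0 : Rd d) 1,
    Wp p (proj (θ : Rd d) (emp XY.1)) (proj (θ : Rd d) (emp XY.2)) ∂(mb m μ ν)

/-- Max-sliced Wasserstein distance. -/
def MaxSW {d : ℕ} (p : ℝ) (μ ν : Measure (Rd d)) : ℝ≥0∞ :=
  ⨆ θ : Metric.sphere (0 : Rd d) 1, Wp p (proj (θ : Rd d) μ) (proj (θ : Rd d) ν)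

/-- Finite p-th moment. -/
def FiniteMoment {E : Type*} [MeasurableSpace E] [NNNorm E] (p : ℝ) (μ : Measure E) : Prop :=
  ∫⁻ x, (‖x‖₊ : ℝ≥0∞) ^ p ∂μ ≠ ∞

/-- The Wasserstein distance between two Dirac masses is at least the distance of the points. -/
lemma edist_le_Wp_dirac {E : Type*} [MeasurableSpace E] [MeasurableSingletonClass E] [EDist E]
    {p : ℝ} (hp : 0 < p) (a b : E) :
    edist a b ≤ Wp p (Measure.dirac a) (Measure.dirac b) := by
  refine le_iInf₂ fun π ⟨hfst, hsnd⟩ => ?_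
  have hfst_ae : ∀ᵐ q ∂π, q.1 = a := by
    refine ae_of_ae_map measurable_fst.aemeasurable (p := fun x => x = a) ?_
    rw [hfst, ae_dirac_eq]
    exact rfl
  have hsnd_ae : ∀ᵐ q ∂π, q.2 = b := by
    refine ae_of_ae_map measurable_snd.aemeasurable (p := fun x => x = b) ?_
    rw [hsnd, ae_dirac_eq]
    exact rfl
  have hmass : π Set.univ = 1 := by
    rw [← Set.preimage_univ (f := Prod.fst), ← Measure.map_apply measurable_fst .univ, hfst,
      measure_univ]
  have hcost : ∫⁻ q, edist q.1 q.2 ^ p ∂π = edist a b ^ p := by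
    rw [lintegral_congr_ae (g := fun _ => edist a b ^ p), lintegral_const, hmass, mul_one]
    filter_upwards [hfst_ae, hsnd_ae] with q h₁ h₂
    rw [h₁, h₂]
  rw [hcost, one_div, ENNReal.rpow_rpow_inv hp.ne']

lemma emp_const {d m : ℕ} (hm : m ≠ 0) (x : Rd d) :
    emp (fun _ : Fin m => x) = Measure.dirac x := by
  rw [emp, Finset.sum_const, Finset.card_univ, Fintype.card_fin, ← Nat.cast_smul_eq_nsmul ℝ≥0∞,
    smul_smul, ENNReal.inv_mul_cancel (by exact_mod_cast hm) (ENNReal.natCast_ne_top m), one_smul]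

lemma proj_dirac {d : ℕ} (θ x : Rd d) :
    proj θ (Measure.dirac x) = Measure.dirac (inner ℝ θ x) :=
  Measure.map_dirac' (by fun_prop) x

/-- The mini-batch max-sliced loss is positive as soon as both measures charge distinct points. -/
lemma mMaxSW_pos_of_singleton {d m : ℕ} {p : ℝ} (hp : 0 < p) (hm : m ≠ 0) {μ ν : Measure (Rd d)}
    [SigmaFinite μ] [SigmaFinite ν] {x y : Rd d} (hxy : x ≠ y) (hx : μ {x} ≠ 0) (hy : ν {y} ≠ 0) :
    0 < mMaxSW p m μ ν := by
  set XY : (Fin m → Rd d) × (Fin m → Rd d) := (fun _ => x, fun _ => y)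
  have hmass : mb m μ ν {XY} ≠ 0 := by
    rw [mb, ← Set.singleton_prod_singleton, Measure.prod_prod, Measure.pi_singleton,
      Measure.pi_singleton]
    simp [hx, hy]
  refine lt_of_lt_of_le ?_ (setLIntegral_le_lintegral {XY} _)
  rw [lintegral_singleton]
  refine ENNReal.mul_pos (ne_of_gt ?_) hmass
  have hnorm : ‖x - y‖ ≠ 0 := norm_ne_zero_iff.mpr (sub_ne_zero.mpr hxy)
  set θ : Rd d := ‖x - y‖⁻¹ • (x - y) with hθ
  have hθ_mem : θ ∈ Metric.sphere (0 : Rd d) 1 := by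
    rw [mem_sphere_zero_iff_norm, hθ, norm_smul, norm_inv, norm_norm, inv_mul_cancel₀ hnorm]
  refine lt_of_lt_of_le ?_ (le_iSup _ (⟨θ, hθ_mem⟩ : Metric.sphere (0 : Rd d) 1))
  rw [emp_const hm, emp_const hm, proj_dirac, proj_dirac]
  refine lt_of_lt_of_le (edist_pos.mpr fun h => ?_) (edist_le_Wp_dirac hp _ _)
  rw [← sub_eq_zero, ← inner_sub_right] at h
  change inner ℝ θ (x - y) = 0 at h
  rw [hθ, real_inner_smul_left, real_inner_self_eq_norm_sq] at h
  simp [hnorm] at h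

theorem mmaxsw_fails_identity {d m : ℕ} (p : ℝ) (hp : 1 ≤ p) (hd : 1 ≤ d) (hm : 2 ≤ m) :
    ∃ μ : Measure (Rd d), IsProbabilityMeasure μ ∧ 0 < mMaxSW p m μ μ := by
  have : Nonempty (Fin d) := ⟨⟨0, hd⟩⟩
  obtain ⟨x, y, hxy⟩ := exists_pair_ne (Rd d)
  set μ : Measure (Rd d) := (2⁻¹ : ℝ≥0∞) • Measure.dirac x + (2⁻¹ : ℝ≥0∞) • Measure.dirac y with hμ
  have hprob : IsProbabilityMeasure μ := ⟨by simp [hμ, ENNReal.inv_two_add_inv_two]⟩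
  exact ⟨μ, hprob, mMaxSW_pos_of_singleton (by linarith) (by omega) hxy (by simp [hμ])
    (by simp [hμ])⟩
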